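/- Let {v₁,...,vₙ} be an orthonormal basis of ℝⁿ, L an n×n real matrix with ‖Lvᵢ‖ = 1 for every i, 1 ≤ m ≤ n, and A = Σ_{i=1}^m (Lvᵢ)(Lvᵢ)ᵀ. Let δ > 0, b' = b − δ, b' > δ, assume A has exactly m nonzero eigenvalues (with multiplicity), each greater than b, and assume Tr[Lᵀ(A − bI)⁻¹L] ≤ −n − 2‖L‖²/δ. Then there exists an index j with m < j ≤ n such that ω = Lvⱼ satisfies: ωᵀ(A − b'I)⁻¹ω < −1, and Tr[Lᵀ(A − b'I)⁻¹L] − (ωᵀ(A − b'I)⁻¹L Lᵀ(A − b'I)⁻¹ω)/(1 + ωᵀ(A − b'I)⁻¹ω) ≤ Tr[Lᵀ(A − bI)⁻¹L]. -/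

import Mathlib

open Matrix

namespace Matrix

variable {n : Type*} [Fintype n]

lemma dotProduct_self_nonneg (x : n → ℝ) : 0 ≤ x ⬝ᵥ x :=
  Finset.sum_nonneg fun i _ => mul_self_nonneg (x i)

lemma trace_mul_vecMulVec_self (X : Matrix n n ℝ) (w : n → ℝ) :
    (X * vecMulVec w w).trace = w ⬝ᵥ (X *ᵥ w) := by
  rw [mul_vecMulVec, trace_vecMulVec, dotProduct_comm]

variable [DecidableEq n]

/-- The inverse of a shift `A - b • 1` of an orthogonally diagonalized matrix. -/
lemma inv_sub_smul_one_of_eq_conj_diagonal {A U : Matrix n n ℝ} {d : n → ℝ}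
    (hU : U * Uᵀ = 1) (hA : A = U * diagonal d * Uᵀ) {b : ℝ} (hb : ∀ i, d i ≠ b) :
    (A - b • 1)⁻¹ = U * diagonal (fun i => (d i - b)⁻¹) * Uᵀ := by
  have hU' : Uᵀ * U = 1 := mul_eq_one_comm.mp hU
  have hshift : A - b • 1 = U * diagonal (fun i => d i - b) * Uᵀ := by
    have hdiag : diagonal (fun i => d i - b) = diagonal d - b • (1 : Matrix n n ℝ) := by
      rw [smul_one_eq_diagonal, diagonal_sub]
    rw [hdiag, mul_sub, sub_mul, ← hA, mul_smul_comm, mul_one, smul_mul_assoc, hU]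
  refine inv_eq_left_inv ?_
  calc (U * diagonal (fun i => (d i - b)⁻¹) * Uᵀ) * (A - b • 1)
      = U * (diagonal (fun i => (d i - b)⁻¹) * (Uᵀ * U) * diagonal (fun i => d i - b)) * Uᵀ := by
        rw [hshift]; simp only [Matrix.mul_assoc]
    _ = 1 := by
        rw [hU', mul_one, diagonal_mul_diagonal]
        have : (fun i => (d i - b)⁻¹ * (d i - b)) = fun _ => (1 : ℝ) :=
          funext fun i => inv_mul_cancel₀ (sub_ne_zero.mpr (hb i))
        rw [this, diagonal_one, mul_one, hU]

lemma conj_diagonal_mul_conj_diagonal {U : Matrix n n ℝ} (hU : Uᵀ * U = 1) (d e : n → ℝ) :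
    (U * diagonal d * Uᵀ) * (U * diagonal e * Uᵀ) = U * diagonal (fun i => d i * e i) * Uᵀ := by
  rw [← diagonal_mul_diagonal]
  calc (U * diagonal d * Uᵀ) * (U * diagonal e * Uᵀ)
      = U * diagonal d * (Uᵀ * U) * diagonal e * Uᵀ := by simp only [Matrix.mul_assoc]
    _ = _ := by rw [hU, mul_one]; simp only [Matrix.mul_assoc]

lemma trace_transpose_mul_conj_diagonal_mul (L U : Matrix n n ℝ) (d : n → ℝ) :
    (Lᵀ * (U * diagonal d * Uᵀ) * L).trace = ∑ i, d i * ((Lᵀ *ᵥ U.col i) ⬝ᵥ (Lᵀ *ᵥ U.col i)) := by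
  have h : (Lᵀ * (U * diagonal d * Uᵀ) * L).trace = (diagonal d * ((Lᵀ * U)ᵀ * (Lᵀ * U))).trace := by
    rw [transpose_mul, transpose_transpose,
      show Lᵀ * (U * diagonal d * Uᵀ) * L = (Lᵀ * U) * (diagonal d * (Uᵀ * L)) by
        simp only [Matrix.mul_assoc], trace_mul_comm]
    simp only [Matrix.mul_assoc]
  rw [h]
  simp only [trace, diag_apply, diagonal_mul]
  rfl

/-- The trace of a quadratic form computed in an orthonormal basis. -/
lemma sum_dotProduct_mulVec_eq_trace {v : n → n → ℝ}
    (hv : ∀ i j, v i ⬝ᵥ v j = if i = j then (1 : ℝ) else 0) (L X : Matrix n n ℝ) :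
    ∑ j, (L *ᵥ v j) ⬝ᵥ (X *ᵥ (L *ᵥ v j)) = (Lᵀ * X * L).trace := by
  have hV : of v * (of v)ᵀ = 1 := by
    ext i j
    rw [mul_apply', one_apply, ← hv i j]
    rfl
  have hV' : (of v)ᵀ * of v = 1 := mul_eq_one_comm.mp hV
  have hterm : ∀ j, (L *ᵥ v j) ⬝ᵥ (X *ᵥ (L *ᵥ v j)) = (of v * (Lᵀ * X * L) * (of v)ᵀ) j j := by
    intro j
    have : (of v * (Lᵀ * X * L) * (of v)ᵀ) j j = v j ⬝ᵥ ((Lᵀ * X * L) *ᵥ v j) := by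
      rw [dotProduct_mulVec]; rfl
    rw [this, Matrix.mul_assoc, ← mulVec_mulVec, ← mulVec_mulVec, dotProduct_mulVec (v j) Lᵀ,
      vecMul_transpose]
  calc ∑ j, (L *ᵥ v j) ⬝ᵥ (X *ᵥ (L *ᵥ v j)) = (of v * (Lᵀ * X * L) * (of v)ᵀ).trace :=
        Finset.sum_congr rfl fun j _ => hterm j
    _ = _ := by rw [trace_mul_comm, ← Matrix.mul_assoc, hV', Matrix.one_mul]

/-- The transpose of a matrix is bounded by the Euclidean operator norm of the matrix. -/
lemma dotProduct_transpose_mulVec_self_le (L : Matrix n n ℝ) (x : n → ℝ) :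
    (Lᵀ *ᵥ x) ⬝ᵥ (Lᵀ *ᵥ x) ≤ ‖toEuclideanCLM (𝕜 := ℝ) L‖ ^ 2 * (x ⬝ᵥ x) := by
  have hsq : ∀ y : n → ℝ, y ⬝ᵥ y = ‖WithLp.toLp 2 y‖ ^ 2 := by
    intro y
    rw [EuclideanSpace.real_norm_sq_eq]
    simp [dotProduct, sq]
  have hnorm : ‖toEuclideanCLM (𝕜 := ℝ) Lᵀ‖ = ‖toEuclideanCLM (𝕜 := ℝ) L‖ := by
    rw [← conjTranspose_eq_transpose_of_trivial, ← star_eq_conjTranspose, map_star,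
      ContinuousLinearMap.star_eq_adjoint, LinearIsometryEquiv.norm_map]
  have hle := (toEuclideanCLM (𝕜 := ℝ) Lᵀ).le_opNorm (WithLp.toLp 2 x)
  rw [toEuclideanCLM_toLp, hnorm] at hle
  rw [hsq, hsq, ← mul_pow]
  exact pow_le_pow_left₀ (norm_nonneg _) hle 2

lemma IsHermitian.exists_eq_conj_diagonal {A : Matrix n n ℝ} (hA : A.IsHermitian) :
    ∃ U : Matrix n n ℝ, U * Uᵀ = 1 ∧ A = U * diagonal hA.eigenvalues * Uᵀ := by
  refine ⟨hA.eigenvectorUnitary, ?_, ?_⟩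
  · have := Unitary.coe_mul_star_self hA.eigenvectorUnitary
    rwa [Unitary.coe_star, star_eq_conjTranspose, conjTranspose_eq_transpose_of_trivial] at this
  · have := hA.spectral_theorem
    rw [Unitary.conjStarAlgAut_apply, star_eq_conjTranspose,
      conjTranspose_eq_transpose_of_trivial] at this
    exact this

end Matrix

/-- A squared resolvent at `b - δ` is controlled by the increment of the resolvent up to `b`. -/
lemma inv_sub_mul_self_le {b δ x : ℝ} (hδ : 0 < δ) (hb : δ < b - δ) (hx : x ≠ 0 → b < x) :
    (x - (b - δ))⁻¹ * (x - (b - δ))⁻¹ ≤ 2 / δ * ((x - b)⁻¹ - (x - (b - δ))⁻¹) := by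
  by_cases h0 : x = 0
  · subst h0
    have hb0 : 0 < b := by linarith
    have hb1 : 0 < b - δ := by linarith
    have hdiff : 2 / δ * ((0 - b)⁻¹ - (0 - (b - δ))⁻¹) - (0 - (b - δ))⁻¹ * (0 - (b - δ))⁻¹
        = (b - 2 * δ) / (b * (b - δ) ^ 2) := by
      rw [zero_sub, zero_sub, inv_neg, inv_neg]
      field_simp
      ring
    have : 0 ≤ (b - 2 * δ) / (b * (b - δ) ^ 2) := div_nonneg (by linarith) (by positivity)
    linarith
  · have hx0 : 0 < x - b := sub_pos.mpr (hx h0)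
    have hx1 : 0 < x - (b - δ) := by linarith
    have hdiff : 2 / δ * ((x - b)⁻¹ - (x - (b - δ))⁻¹) - (x - (b - δ))⁻¹ * (x - (b - δ))⁻¹
        = (x - b + 2 * δ) / ((x - b) * (x - (b - δ)) ^ 2) := by
      field_simp
      ring
    have : 0 ≤ (x - b + 2 * δ) / ((x - b) * (x - (b - δ)) ^ 2) :=
      div_nonneg (by linarith) (by positivity)
    linarith

/-- Step 4 — existence of a good vector `ω = Lvⱼ`, `m < j ≤ n`. -/
theorem step_four_good_vector
    (n m : ℕ) (hm1 : 1 ≤ m) (hmn : m ≤ n)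
    (v : Fin n → Fin n → ℝ)
    (hortho : ∀ i j : Fin n, v i ⬝ᵥ v j = if i = j then (1 : ℝ) else 0)
    (L : Matrix (Fin n) (Fin n) ℝ)
    (hnorm : ∀ i : Fin n, (L *ᵥ v i) ⬝ᵥ (L *ᵥ v i) = 1)
    (A : Matrix (Fin n) (Fin n) ℝ)
    (hAdef : A = ∑ i ∈ Finset.univ.filter (fun i : Fin n => (i : ℕ) < m),
        vecMulVec (L *ᵥ v i) (L *ᵥ v i))
    (b δ b' : ℝ) (hδ : 0 < δ) (hb' : b' = b - δ) (hδb' : δ < b')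
    (hA : A.IsHermitian)
    (hcard : (Finset.univ.filter (fun i : Fin n => hA.eigenvalues i ≠ 0)).card = m)
    (heig : ∀ i : Fin n, hA.eigenvalues i ≠ 0 → b < hA.eigenvalues i)
    (htr : (Lᵀ * (A - b • 1)⁻¹ * L).trace ≤
      -(n : ℝ) - 2 * ‖Matrix.toEuclideanCLM (𝕜 := ℝ) L‖ ^ 2 / δ) :
    ∃ j : Fin n, m ≤ (j : ℕ) ∧
      (L *ᵥ v j) ⬝ᵥ ((A - b' • 1)⁻¹ *ᵥ (L *ᵥ v j)) < -1 ∧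
      (Lᵀ * (A - b' • 1)⁻¹ * L).trace -
          ((L *ᵥ v j) ⬝ᵥ (((A - b' • 1)⁻¹ * L * Lᵀ * (A - b' • 1)⁻¹) *ᵥ (L *ᵥ v j))) /
            (1 + (L *ᵥ v j) ⬝ᵥ ((A - b' • 1)⁻¹ *ᵥ (L *ᵥ v j))) ≤
        (Lᵀ * (A - b • 1)⁻¹ * L).trace := by
  subst hb'
  obtain ⟨U, hU, hAU⟩ := hA.exists_eq_conj_diagonal
  have hU' : Uᵀ * U = 1 := mul_eq_one_comm.mp hU
  set d := hA.eigenvalues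
  have hdb : ∀ i, d i ≠ b := fun i h => by
    have := heig i (by rw [h]; linarith)
    linarith
  have hdb' : ∀ i, d i ≠ b - δ := fun i h => by
    have := heig i (by rw [h]; linarith)
    linarith
  set M := (A - (b - δ) • (1 : Matrix (Fin n) (Fin n) ℝ))⁻¹ with hM
  set N := (A - b • (1 : Matrix (Fin n) (Fin n) ℝ))⁻¹ with hN
  rw [inv_sub_smul_one_of_eq_conj_diagonal hU hAU hdb'] at hM
  rw [inv_sub_smul_one_of_eq_conj_diagonal hU hAU hdb] at hN
  have hMT : Mᵀ = M := by
    rw [hM]; simp only [transpose_mul, transpose_transpose, diagonal_transpose, Matrix.mul_assoc]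
  have hMsq : ∀ x : Fin n → ℝ, x ⬝ᵥ ((M * M) *ᵥ x) = (M *ᵥ x) ⬝ᵥ (M *ᵥ x) := fun x => by
    rw [← mulVec_mulVec, dotProduct_mulVec, ← mulVec_transpose, hMT]
  set K := ‖Matrix.toEuclideanCLM (𝕜 := ℝ) L‖ ^ 2
  have hK : 0 ≤ K := sq_nonneg _
  set p : Fin n → ℝ := fun j => (L *ᵥ v j) ⬝ᵥ (M *ᵥ (L *ᵥ v j)) with hp
  set q : Fin n → ℝ := fun j => (L *ᵥ v j) ⬝ᵥ ((M * L * Lᵀ * M) *ᵥ (L *ᵥ v j)) with hq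
  set S := (Lᵀ * (M * M) * L).trace with hS
  set Δ := (Lᵀ * N * L).trace - (Lᵀ * M * L).trace with hΔ
  have hSsum : ∑ j, (M *ᵥ (L *ᵥ v j)) ⬝ᵥ (M *ᵥ (L *ᵥ v j)) = S := by
    rw [hS, ← sum_dotProduct_mulVec_eq_trace hortho]
    exact Finset.sum_congr rfl fun j _ => (hMsq _).symm
  have hSle : S ≤ 2 / δ * Δ := by
    rw [hS, hΔ, hM, hN, conj_diagonal_mul_conj_diagonal hU', trace_transpose_mul_conj_diagonal_mul,
      trace_transpose_mul_conj_diagonal_mul, trace_transpose_mul_conj_diagonal_mul,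
      ← Finset.sum_sub_distrib, Finset.mul_sum]
    refine Finset.sum_le_sum fun i _ => ?_
    rw [← sub_mul, ← mul_assoc]
    exact mul_le_mul_of_nonneg_right (inv_sub_mul_self_le hδ hδb' (heig i))
      (dotProduct_self_nonneg _)
  have hSpos : 0 < S := by
    rw [← hSsum]
    let j : Fin n := ⟨0, by omega⟩
    refine Finset.sum_pos' (fun j _ => dotProduct_self_nonneg _) ⟨j, Finset.mem_univ _, ?_⟩
    refine lt_of_le_of_ne (dotProduct_self_nonneg _) fun h => ?_
    have hzero : M *ᵥ (L *ᵥ v j) = 0 := dotProduct_self_eq_zero.mp h.symm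
    have hinv : (U * diagonal (fun i => d i - (b - δ)) * Uᵀ) * M = 1 := by
      rw [hM, conj_diagonal_mul_conj_diagonal hU',
        funext fun i => mul_inv_cancel₀ (sub_ne_zero.mpr (hdb' i)), diagonal_one, mul_one, hU]
    have hLv : L *ᵥ v j = 0 := by
      rw [← one_mulVec (L *ᵥ v j), ← hinv, ← mulVec_mulVec, hzero, mulVec_zero]
    simpa [hLv] using hnorm j
  have hΔpos : 0 < Δ := by
    have : 0 < 2 / δ * Δ := hSpos.trans_le hSle
    exact (mul_pos_iff_of_pos_left (by positivity)).mp this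
  have hq_eq : ∀ j, q j = (Lᵀ *ᵥ (M *ᵥ (L *ᵥ v j))) ⬝ᵥ (Lᵀ *ᵥ (M *ᵥ (L *ᵥ v j))) := fun j => by
    simp only [hq, ← mulVec_mulVec]
    rw [dotProduct_mulVec, ← mulVec_transpose, hMT, dotProduct_mulVec _ L, ← mulVec_transpose]
  have hq_nonneg : ∀ j, 0 ≤ q j := fun j => by
    rw [hq_eq]; exact dotProduct_self_nonneg _
  have hq_sum : ∑ j, q j ≤ K * S := by
    rw [← hSsum, Finset.mul_sum]
    refine Finset.sum_le_sum fun j _ => ?_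
    rw [hq_eq]
    exact dotProduct_transpose_mulVec_self_le L _
  have hp_sum : ∑ j, p j = (Lᵀ * M * L).trace := sum_dotProduct_mulVec_eq_trace hortho L M
  have hp_used : 0 ≤ ∑ j ∈ Finset.univ.filter (fun j : Fin n => (j : ℕ) < m), p j := by
    have hMA : ∑ j ∈ Finset.univ.filter (fun j : Fin n => (j : ℕ) < m), p j = (M * A).trace := by
      rw [hAdef, Finset.mul_sum, trace_sum]
      exact Finset.sum_congr rfl fun j _ => (trace_mul_vecMulVec_self M _).symm
    rw [hMA, hM, hAU, conj_diagonal_mul_conj_diagonal hU', trace_mul_comm, ← Matrix.mul_assoc, hU',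
      Matrix.one_mul, trace_diagonal]
    refine Finset.sum_nonneg fun i _ => ?_
    by_cases hi : d i = 0
    · simp [hi]
    · have := heig i hi
      exact mul_nonneg (inv_nonneg.mpr (by linarith)) (by linarith)
  have hsplit_p := Finset.sum_filter_add_sum_filter_not Finset.univ (fun j : Fin n => (j : ℕ) < m) p
  set J := Finset.univ.filter fun j : Fin n => ¬ (j : ℕ) < m
  have hlt : ∑ j ∈ J, q j < ∑ j ∈ J, Δ * (-1 - p j) := by
    have hleft : ∑ j ∈ J, q j ≤ K * (2 / δ * Δ) :=
      (Finset.sum_le_sum_of_subset_of_nonneg (Finset.filter_subset _ _)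
        fun j _ _ => hq_nonneg j).trans
        (hq_sum.trans (mul_le_mul_of_nonneg_left hSle hK))
    have hcount : (J.card : ℝ) ≤ n := by
      exact_mod_cast (Finset.card_filter_le _ _).trans_eq (Finset.card_fin n)
    rw [← Finset.mul_sum, Finset.sum_sub_distrib, Finset.sum_const, nsmul_eq_mul]
    have hlower : 2 * K / δ + Δ ≤ (J.card : ℝ) * -1 - ∑ j ∈ J, p j := by
      linarith
    calc _ ≤ K * (2 / δ * Δ) := hleft
      _ < Δ * (2 * K / δ + Δ) := by
        have : Δ * (2 * K / δ + Δ) = K * (2 / δ * Δ) + Δ * Δ := by ring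
        rw [this]
        exact lt_add_of_pos_right _ (mul_pos hΔpos hΔpos)
      _ ≤ _ := mul_le_mul_of_nonneg_left hlower hΔpos.le
  obtain ⟨j, hj, hjlt⟩ := Finset.exists_lt_of_sum_lt hlt
  have hpj : 0 < -1 - p j :=
    (mul_pos_iff_of_pos_left hΔpos).mp ((hq_nonneg j).trans_lt hjlt)
  refine ⟨j, not_lt.mp (Finset.mem_filter.mp hj).2, by linarith, ?_⟩
  change (Lᵀ * M * L).trace - q j / (1 + p j) ≤ (Lᵀ * N * L).trace
  have hdiv : q j / (-1 - p j) ≤ Δ := (div_le_iff₀ hpj).mpr hjlt.le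
  have hneg : q j / (1 + p j) = -(q j / (-1 - p j)) := by
    rw [← div_neg]; ring_nf
  linarith
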